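/- Let K ⊆ ℝ³ be a compact invariant set for an injective continuous map f : ℝ³ → ℝ³, and assume K is a global attractor, i.e. every compact set P ⊆ ℝ³ is attracted by K. Then K is cellular. -/

import Mathlib

open Set

noncomputable section

/-- Euclidean 3-space. -/
abbrev R3 := EuclideanSpace ℝ (Fin 3)

/-- A compact set `P ⊆ ℝ³` is attracted by `K` under `f : ℝ³ → ℝ³` if for every
neighbourhood `V` of `K` there is `n₀` with `fⁿ(P) ⊆ V` for all `n ≥ n₀`. -/
def IsAttracted (f : R3 → R3) (K P : Set R3) : Prop :=
  ∀ V : Set R3, K ⊆ interior V → ∃ n₀ : ℕ, ∀ n ≥ n₀, f^[n] '' P ⊆ V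

/-- `K ⊆ ℝ³` is cellular: it has arbitrarily small neighbourhoods homeomorphic to the
closed unit ball of `ℝ³`. -/
def IsCellular (K : Set R3) : Prop :=
  ∀ V : Set R3, IsOpen V → K ⊆ V →
    ∃ B : Set R3, K ⊆ interior B ∧ B ⊆ V ∧
      Nonempty (↥B ≃ₜ ↥(Metric.closedBall (0 : R3) 1))

open MeasureTheory Metric Function in
theorem bijective_add_of_lipschitzWith {E : Type*} [NormedAddCommGroup E] [CompleteSpace E]
    {w : E → E} {C : NNReal} (hw : LipschitzWith C w) (hC : C < 1) :
    Bijective fun x => x + w x := by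
  constructor
  · intro x y hxy
    have h1 : x - y = w y - w x := by
      rw [sub_eq_sub_iff_add_eq_add, show x + w x = y + w y from hxy, add_comm]
    have h2 := hw.dist_le_mul y x
    rw [dist_eq_norm, ← h1, dist_comm, dist_eq_norm] at h2
    have h3 : (C : ℝ) < 1 := by exact_mod_cast hC
    by_contra hne
    have h4 : 0 < ‖x - y‖ := norm_pos_iff.2 (sub_ne_zero.2 hne)
    nlinarith
  · intro y
    have hc : ContractingWith C fun x => y - w x :=
      ⟨hC, LipschitzWith.of_dist_le_mul fun a b =>
        (dist_sub_left y (w a) (w b)).trans_le (hw.dist_le_mul a b)⟩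
    refine ⟨hc.fixedPoint, ?_⟩
    have := hc.fixedPoint_isFixedPt
    rw [IsFixedPt] at this
    exact (sub_eq_iff_eq_add.1 this).symm

theorem image_eq_self_of_eqOn_compl {α : Type*} {φ : α → α} (hφ : Function.Bijective φ) {U : Set α}
    (h : ∀ x ∉ U, φ x = x) : φ '' U = U := by
  apply compl_injective
  rw [← image_compl_eq hφ]
  ext x
  constructor
  · rintro ⟨y, hy, rfl⟩
    rwa [h y hy]
  · exact fun hx => ⟨x, hx, h x hx⟩

open Metric in
/-- A map that is Lipschitz on the closed unit ball and vanishes on the unit sphere remains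
Lipschitz when it is extended by zero. -/
theorem lipschitzWith_indicator_closedBall {E F : Type*} [NormedAddCommGroup E] [NormedSpace ℝ E]
    [NormedAddCommGroup F] {u : E → F} {C : NNReal} (hu : LipschitzOnWith C u (closedBall 0 1))
    (h0 : ∀ x, ‖x‖ = 1 → u x = 0) : LipschitzWith C ((closedBall (0 : E) 1).indicator u) := by
  have key : ∀ x y : E, ‖x‖ ≤ 1 → 1 < ‖y‖ → ‖u x‖ ≤ C * ‖x - y‖ := by
    intro x y hx hy
    obtain ⟨t, ht, ht1⟩ : ∃ t ∈ Icc (0 : ℝ) 1, ‖x + t • (y - x)‖ = 1 := by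
      have hc : ContinuousOn (fun t : ℝ => ‖x + t • (y - x)‖) (Icc 0 1) := by fun_prop
      exact intermediate_value_Icc zero_le_one hc (by simp [hx, hy.le])
    have h := hu.norm_sub_le (x := x) (by simpa using hx) (y := x + t • (y - x))
      (by simp [ht1])
    rw [h0 _ ht1, sub_zero] at h
    refine h.trans ?_
    have : ‖x - (x + t • (y - x))‖ = t * ‖x - y‖ := by
      rw [sub_add_cancel_left, norm_neg, norm_smul, Real.norm_of_nonneg ht.1, norm_sub_rev]
    rw [this]
    gcongr
    exact mul_le_of_le_one_left (norm_nonneg _) ht.2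
  refine LipschitzWith.of_dist_le_mul fun x y => ?_
  simp only [dist_eq_norm]
  by_cases hx : x ∈ closedBall (0 : E) 1 <;> by_cases hy : y ∈ closedBall (0 : E) 1
  · simpa [hx, hy, -mem_closedBall] using hu.norm_sub_le hx hy
  · simpa [hx, hy, -mem_closedBall] using key x y (by simpa using hx) (by simpa using hy)
  · rw [norm_sub_rev x y]
    simpa [hx, hy, -mem_closedBall] using key y x (by simpa using hy) (by simpa using hx)
  · simp only [indicator_of_notMem hx, indicator_of_notMem hy, sub_zero, norm_zero]
    positivity

/-- The value at `1` of the polynomial `t ↦ det (1 + t A)` is an affine combination, with weights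
independent of `A`, of its values at small nonnegative parameters. -/
theorem exists_weights_det_one_add_smul (E : Type*) [NormedAddCommGroup E] [NormedSpace ℝ E]
    [FiniteDimensional ℝ E] {ε : ℝ} (hε : 0 < ε) :
    ∃ (s : Finset ℕ) (t l : ℕ → ℝ), (∀ i ∈ s, 0 ≤ t i ∧ t i < ε) ∧ ∑ i ∈ s, l i = 1 ∧
      ∀ A : E →L[ℝ] E, (ContinuousLinearMap.id ℝ E + A).det =
        ∑ i ∈ s, l i * (ContinuousLinearMap.id ℝ E + t i • A).det := by
  set n := Module.finrank ℝ E
  set v : ℕ → ℝ := fun i => ε * i / (n + 1)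
  have hn : (0 : ℝ) < n + 1 := by positivity
  have hv : Set.InjOn v (Finset.range (n + 1)) := by
    intro i _ j _ hij
    simp only [v] at hij
    field_simp at hij
    exact_mod_cast hij
  refine ⟨Finset.range (n + 1), v,
    fun i => (Lagrange.basis (Finset.range (n + 1)) v i).eval 1, ?_, ?_, ?_⟩
  · intro i hi
    refine ⟨by positivity, ?_⟩
    simp only [v]
    rw [div_lt_iff₀ hn]
    have : (i : ℝ) < n + 1 := by exact_mod_cast Finset.mem_range.1 hi
    gcongr
  · rw [← Polynomial.eval_finsetSum, Lagrange.sum_basis hv ⟨0, by simp⟩, Polynomial.eval_one]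
  · intro A
    set b := Module.finBasis ℝ E
    set M := LinearMap.toMatrix b b (A : E →ₗ[ℝ] E)
    set P := Matrix.det ((Polynomial.X : Polynomial ℝ) • M.map Polynomial.C
      + (1 : Matrix (Fin n) (Fin n) ℝ).map Polynomial.C)
    have hP : ∀ x : ℝ, P.eval x = (ContinuousLinearMap.id ℝ E + x • A).det := by
      intro x
      rw [ContinuousLinearMap.det, ← LinearMap.det_toMatrix b, ← Polynomial.coe_evalRingHom,
        RingHom.map_det]
      congr 1
      have : LinearMap.toMatrix b b ((ContinuousLinearMap.id ℝ E + x • A : E →L[ℝ] E) : E →ₗ[ℝ] E)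
          = 1 + x • M := by
        simp [M]
      rw [this]
      ext i j
      simp only [RingHom.mapMatrix_apply, Matrix.map_apply, Matrix.add_apply, Matrix.smul_apply,
        smul_eq_mul, Polynomial.coe_evalRingHom, Polynomial.eval_add, Polynomial.eval_mul,
        Polynomial.eval_X, Polynomial.eval_C]
      ring
    have hdeg : P.degree < (Finset.range (n + 1)).card := by
      refine lt_of_le_of_lt Polynomial.degree_le_natDegree ?_
      have := Polynomial.natDegree_det_X_add_C_le M (1 : Matrix (Fin n) (Fin n) ℝ)
      rw [Finset.card_range]
      rw [Fintype.card_fin] at this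
      exact_mod_cast Nat.lt_succ_of_le this
    have h := Lagrange.eq_interpolate_of_eval_eq (fun i => P.eval (v i)) hv hdeg fun _ _ => rfl
    have h1 := congrArg (Polynomial.eval 1) h
    rw [Lagrange.interpolate_apply, Polynomial.eval_finsetSum, hP, one_smul] at h1
    rw [h1]
    refine Finset.sum_congr rfl fun i _ => ?_
    rw [Polynomial.eval_mul, Polynomial.eval_C, hP, mul_comm]

open MeasureTheory Metric in
/-- For small `t`, the map `x ↦ x + t u(x)` permutes the unit ball if `u` vanishes on its
boundary, so its Jacobian determinant integrates to the volume of the ball. -/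
theorem exists_integral_det_id_add_smul_fderiv {E : Type*} [NormedAddCommGroup E] [NormedSpace ℝ E]
    [FiniteDimensional ℝ E] [MeasurableSpace E] [BorelSpace E] (μ : Measure E) [μ.IsAddHaarMeasure]
    {u : E → E} (hu : ContDiff ℝ 1 u) (h0 : ∀ x, ‖x‖ = 1 → u x = 0) :
    ∃ ε : ℝ, 0 < ε ∧ ∀ t : ℝ, 0 ≤ t → t < ε →
      ∫ x in ball 0 1, (ContinuousLinearMap.id ℝ E + t • fderiv ℝ u x).det ∂μ
        = μ.real (ball 0 1) := by
  have hD : Continuous (fderiv ℝ u) := hu.continuous_fderiv one_ne_zero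
  obtain ⟨C₀, hC₀⟩ := (isCompact_closedBall (0 : E) 1).exists_bound_of_continuousOn hD.continuousOn
  set C : NNReal := C₀.toNNReal + 1
  have hC1 : (1 : ℝ) ≤ C := by simp [C]
  have hC0 : (0 : ℝ) < C := one_pos.trans_le hC1
  have hC : ∀ x ∈ closedBall (0 : E) 1, ‖fderiv ℝ u x‖ ≤ C := fun x hx => by
    have := (hC₀ x hx).trans (Real.le_coe_toNNReal C₀)
    simp only [C, NNReal.coe_add, NNReal.coe_one]
    linarith
  have hLip : LipschitzWith C ((closedBall (0 : E) 1).indicator u) :=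
    lipschitzWith_indicator_closedBall
      ((convex_closedBall 0 1).lipschitzOnWith_of_nnnorm_fderiv_le
        (fun x _ => (hu.differentiable one_ne_zero) x) hC) h0
  obtain ⟨δ, hδ, hdet⟩ : ∃ δ > 0, ∀ A : E →L[ℝ] E, ‖A‖ < δ →
      0 < (ContinuousLinearMap.id ℝ E + A).det := by
    have hc : Continuous fun A : E →L[ℝ] E => (ContinuousLinearMap.id ℝ E + A).det :=
      ContinuousLinearMap.continuous_det.comp (continuous_const.add continuous_id)
    have h1 : (0 : ℝ) < (ContinuousLinearMap.id ℝ E + 0).det := by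
      simp [ContinuousLinearMap.det]
    obtain ⟨δ, hδ, h⟩ := Metric.mem_nhds_iff.1 (hc.continuousAt.eventually (lt_mem_nhds h1))
    exact ⟨δ, hδ, fun A hA => h (by simpa using hA)⟩
  refine ⟨min δ 1 / C, div_pos (lt_min hδ one_pos) hC0, fun t ht hlt => ?_⟩
  rw [lt_div_iff₀ hC0] at hlt
  set w := (closedBall (0 : E) 1).indicator u
  set φ : E → E := fun x => x + t • w x
  have hφ : Function.Bijective φ := by
    refine bijective_add_of_lipschitzWith (C := t.toNNReal * C) (w := fun x => t • w x) ?_ ?_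
    · refine LipschitzWith.of_dist_le_mul fun x y => ?_
      rw [dist_smul₀, NNReal.coe_mul, Real.coe_toNNReal t ht, Real.norm_of_nonneg ht, mul_assoc]
      gcongr
      exact hLip.dist_le_mul x y
    · rw [← NNReal.coe_lt_coe, NNReal.coe_mul, Real.coe_toNNReal t ht]
      exact hlt.trans_le (min_le_right _ _)
  have himage : φ '' ball 0 1 = ball 0 1 := by
    refine image_eq_self_of_eqOn_compl hφ fun x hx => ?_
    have hx1 : 1 ≤ ‖x‖ := by simpa using hx
    have : w x = 0 := by
      by_cases hxc : x ∈ closedBall (0 : E) 1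
      · exact (indicator_of_mem hxc u).trans (h0 x (le_antisymm (by simpa using hxc) hx1))
      · exact indicator_of_notMem hxc _
    simp [φ, this]
  have hderiv : ∀ x ∈ ball (0 : E) 1, HasFDerivWithinAt φ
      (ContinuousLinearMap.id ℝ E + t • fderiv ℝ u x) (ball 0 1) x := by
    intro x hx
    have h : HasFDerivAt (fun x => x + t • u x)
        (ContinuousLinearMap.id ℝ E + t • fderiv ℝ u x) x :=
      (hasFDerivAt_id x).add (((hu.differentiable one_ne_zero) x).hasFDerivAt.const_smul t)
    refine h.hasFDerivWithinAt.congr' (fun y hy => ?_) hx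
    simp only [φ, w, indicator_of_mem (ball_subset_closedBall hy)]
  have hvol := integral_image_eq_integral_abs_det_fderiv_smul μ measurableSet_ball hderiv
    hφ.injective.injOn fun _ => (1 : ℝ)
  rw [himage, setIntegral_const, smul_eq_mul, mul_one] at hvol
  rw [hvol]
  refine setIntegral_congr_fun measurableSet_ball fun x hx => ?_
  have : 0 < (ContinuousLinearMap.id ℝ E + t • fderiv ℝ u x).det := by
    apply hdet
    rw [norm_smul, Real.norm_of_nonneg ht]
    calc t * ‖fderiv ℝ u x‖ ≤ t * C := by
          gcongr
          exact hC x (ball_subset_closedBall hx)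
      _ < δ := hlt.trans_le (min_le_left _ _)
  simp [abs_of_pos this]

open MeasureTheory Metric in
/-- There is no `C¹` retraction of the closed unit ball onto the unit sphere. -/
theorem not_exists_contDiff_retraction_sphere {E : Type*} [NormedAddCommGroup E]
    [InnerProductSpace ℝ E] [FiniteDimensional ℝ E] {r : E → E} (hr : ContDiff ℝ 1 r)
    (hnorm : ∀ x, ‖x‖ ≤ 1 → ‖r x‖ = 1) (hid : ∀ x, ‖x‖ = 1 → r x = x) : False := by
  borelize E
  set μ : Measure E := Measure.addHaar
  set u : E → E := fun x => r x - x
  have hu : ContDiff ℝ 1 u := hr.sub contDiff_id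
  obtain ⟨ε, hε, hint⟩ := exists_integral_det_id_add_smul_fderiv μ hu
    fun x hx => sub_eq_zero.2 (hid x hx)
  obtain ⟨s, t, l, ht, hl, hdet⟩ := exists_weights_det_one_add_smul E hε
  have hzero : ∀ x ∈ ball (0 : E) 1, (ContinuousLinearMap.id ℝ E + fderiv ℝ u x).det = 0 := by
    intro x hx
    have hrd := ((hr.differentiable one_ne_zero) x).hasFDerivAt
    have hsum : ContinuousLinearMap.id ℝ E + fderiv ℝ u x = fderiv ℝ r x := by
      have hud : HasFDerivAt u (fderiv ℝ r x - ContinuousLinearMap.id ℝ E) x :=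
        hrd.sub (hasFDerivAt_id x)
      rw [hud.fderiv]
      abel
    rw [hsum]
    have horth : ∀ v, inner ℝ (r x) (fderiv ℝ r x v) = 0 := by
      intro v
      have hconst : (fun y => ‖r y‖ ^ 2) =ᶠ[nhds x] fun _ => (1 : ℝ) := by
        filter_upwards [isOpen_ball.mem_nhds hx] with y hy
        rw [hnorm y (by simpa using (ball_subset_closedBall hy)), one_pow]
      have h := hconst.fderiv_eq (𝕜 := ℝ)
      rw [hrd.norm_sq.fderiv] at h
      have := DFunLike.congr_fun h v
      simpa using this
    by_contra hne
    have hsurj : Function.Surjective (fderiv ℝ r x) := by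
      exact (LinearMap.equivOfDetNeZero (fderiv ℝ r x : E →ₗ[ℝ] E) hne).surjective
    obtain ⟨v, hv⟩ := hsurj (r x)
    have h := horth v
    rw [hv, real_inner_self_eq_norm_sq, hnorm x (by simpa using (ball_subset_closedBall hx))] at h
    norm_num at h
  have hinteg : ∀ a : ℝ, IntegrableOn
      (fun x => (ContinuousLinearMap.id ℝ E + a • fderiv ℝ u x).det) (ball 0 1) μ := by
    intro a
    have hc : Continuous fun x => (ContinuousLinearMap.id ℝ E + a • fderiv ℝ u x).det :=
      ContinuousLinearMap.continuous_det.comp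
        (continuous_const.add ((hu.continuous_fderiv one_ne_zero).const_smul a))
    exact (hc.continuousOn.integrableOn_compact (isCompact_closedBall 0 1)).mono_set
      ball_subset_closedBall
  have htotal : ∫ x in ball (0 : E) 1, (ContinuousLinearMap.id ℝ E + fderiv ℝ u x).det ∂μ
      = μ.real (ball 0 1) := by
    rw [integral_congr_ae (Filter.Eventually.of_forall fun x => hdet (fderiv ℝ u x))]
    rw [integral_finsetSum _ fun i _ => (hinteg (t i)).const_mul (l i)]
    simp_rw [integral_const_mul]
    rw [Finset.sum_congr rfl fun i hi => by rw [hint (t i) (ht i hi).1 (ht i hi).2],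
      ← Finset.sum_mul, hl, one_mul]
  rw [setIntegral_congr_fun measurableSet_ball hzero, setIntegral_const, smul_zero] at htotal
  have : 0 < μ.real (ball (0 : E) 1) :=
    ENNReal.toReal_pos (measure_ball_pos μ 0 one_pos).ne' measure_ball_lt_top.ne
  exact this.ne htotal

open Metric in
/-- A continuous map of the closed unit ball that is close to the identity has a zero. -/
theorem exists_eq_zero_of_norm_sub_le {E : Type*} [NormedAddCommGroup E]
    [InnerProductSpace ℝ E] [FiniteDimensional ℝ E] {F : E → E}
    (hF : ContinuousOn F (closedBall 0 1)) (hclose : ∀ x ∈ closedBall 0 1, ‖F x - x‖ ≤ 1 / 4) :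
    ∃ x ∈ closedBall 0 1, F x = 0 := by
  by_contra! hne
  obtain ⟨Ft, hFt⟩ := ContinuousMap.exists_restrict_eq (isClosed_closedBall (x := (0 : E)) (ε := 1))
    ⟨(closedBall (0 : E) 1).domRestrict F, continuousOn_iff_continuous_domRestrict.1 hF⟩
  have hFt' : ∀ x ∈ closedBall (0 : E) 1, Ft x = F x := fun x hx =>
    DFunLike.congr_fun hFt ⟨x, hx⟩
  obtain ⟨x₀, hx₀, hmin⟩ := (isCompact_closedBall (0 : E) 1).exists_isMinOn
    (nonempty_closedBall.2 zero_le_one) hF.norm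
  have hpos : 0 < ‖F x₀‖ := norm_pos_iff.2 (hne x₀ hx₀)
  obtain ⟨F₁, hF₁, happrox, -⟩ := Ft.continuous.exists_contDiff_approx 1
    (ε := fun _ => min ‖F x₀‖ (1 / 4)) continuous_const fun _ => by positivity
  have hF₁0 : ∀ x ∈ closedBall (0 : E) 1, F₁ x ≠ 0 := by
    intro x hx h0
    have h := (happrox x).trans_le (min_le_left _ _)
    rw [hFt' x hx, h0, dist_zero_left] at h
    exact absurd (hmin hx) (not_le.2 h)
  have hF₁close : ∀ x ∈ closedBall (0 : E) 1, ‖F₁ x - x‖ < 1 / 2 := by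
    intro x hx
    have h := (happrox x).trans_le (min_le_right _ _)
    rw [hFt' x hx, dist_eq_norm] at h
    have := norm_sub_le_norm_sub_add_norm_sub (F₁ x) (F x) x
    linarith [hclose x hx]
  let χ : ContDiffBump (0 : E) := ⟨1 / 2, 1, by norm_num, by norm_num⟩
  set F₂ : E → E := fun x => x + χ x • (F₁ x - x)
  have hF₂ : ContDiff ℝ 1 F₂ := contDiff_id.add (χ.contDiff.smul (hF₁.sub contDiff_id))
  have hF₂out : ∀ x, 1 ≤ ‖x‖ → F₂ x = x := by
    intro x hx
    simp [F₂, χ.zero_of_le_dist (x := x) (by simpa [χ] using hx)]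
  have hF₂0 : ∀ x, F₂ x ≠ 0 := by
    intro x h0
    rcases le_total 1 ‖x‖ with h1 | h1
    · rw [hF₂out x h1] at h0
      rw [h0, norm_zero] at h1
      exact absurd h1 (by norm_num)
    have hx : x ∈ closedBall (0 : E) 1 := by simpa using h1
    rcases le_total ‖x‖ (1 / 2) with h2 | h2
    · have : χ x = 1 := χ.one_of_mem_closedBall (by simpa [χ] using h2)
      exact hF₁0 x hx (by simpa [F₂, this] using h0)
    · have h3 : x = -(χ x • (F₁ x - x)) := eq_neg_of_add_eq_zero_left h0
      have h4 : ‖x‖ = χ x * ‖F₁ x - x‖ := by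
        conv_lhs => rw [h3, norm_neg, norm_smul, Real.norm_of_nonneg χ.nonneg]
      have h5 := mul_le_of_le_one_left (norm_nonneg (F₁ x - x)) (χ.le_one (x := x))
      linarith [hF₁close x hx]
  refine not_exists_contDiff_retraction_sphere (r := fun x => ‖F₂ x‖⁻¹ • F₂ x)
    (((hF₂.norm ℝ hF₂0).inv fun x => norm_ne_zero_iff.2 (hF₂0 x)).smul hF₂) ?_ ?_
  · intro x _
    rw [norm_smul, norm_inv, norm_norm, inv_mul_cancel₀ (norm_ne_zero_iff.2 (hF₂0 x))]
  · intro x hx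
    simp [hF₂out x hx.ge, hx]

open MeasureTheory Metric in
theorem exists_small_notMem_image_sphere {E : Type*} [NormedAddCommGroup E] [NormedSpace ℝ E]
    [FiniteDimensional ℝ E] {P : E → E} (hP : ContDiff ℝ 1 P) (c : E) {ε δ : ℝ} (hε : 0 < ε)
    (hδ : 0 < δ) : ∃ a, ‖a‖ < δ ∧ a ∉ P '' sphere c ε := by
  borelize E
  set μ : Measure E := Measure.addHaar
  have hnull : μ (P '' sphere c ε) = 0 :=
    addHaar_image_eq_zero_of_differentiableOn_of_addHaar_eq_zero μ
      (hP.differentiable one_ne_zero).differentiableOn (Measure.addHaar_sphere_of_ne_zero μ c hε.ne')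
  by_contra! h
  have hsub : ball (0 : E) δ ⊆ P '' sphere c ε := fun a ha => h a (by simpa using ha)
  exact (measure_ball_pos μ 0 hδ).ne' (measure_mono_null hsub hnull)

open Metric in
theorem Continuous.mem_interior_image_closedBall_of_injective {E : Type*} [NormedAddCommGroup E]
    [InnerProductSpace ℝ E] [FiniteDimensional ℝ E] {g : E → E} (hg : Continuous g)
    (hinj : Function.Injective g) : g 0 ∈ interior (g '' closedBall 0 1) := by
  set B : Set E := closedBall 0 1
  set S := g '' B
  have hB : IsCompact B := isCompact_closedBall 0 1
  have hS : IsCompact S := hB.image hg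
  have : CompactSpace B := isCompact_iff_compactSpace.1 hB
  obtain ⟨G, hG'⟩ := ContinuousMap.exists_extension
    ((hg.comp continuous_subtype_val).isClosedEmbedding (hinj.comp Subtype.val_injective))
    (⟨Subtype.val, continuous_subtype_val⟩ : C(B, E))
  have hG : ∀ x ∈ B, G (g x) = x := fun x hx => DFunLike.congr_fun hG' ⟨x, hx⟩
  have hG0 : G (g 0) = 0 := hG 0 (by simp [B])
  by_contra hnot
  obtain ⟨η, hη, hsmall⟩ : ∃ η > 0, ∀ y, dist y (g 0) < η → ‖G y‖ < 1 / 16 := by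
    have h1 : ‖G (g 0)‖ < 1 / 16 := by rw [hG0, norm_zero]; norm_num
    obtain ⟨η, hη, h⟩ := Metric.mem_nhds_iff.1
      (G.continuous.norm.continuousAt.eventually (gt_mem_nhds h1))
    exact ⟨η, hη, fun y hy => h hy⟩
  set ε := η / 3
  have hε : 0 < ε := by positivity
  obtain ⟨c, hcball, hcS⟩ : ∃ c ∈ ball (g 0) ε, c ∉ S := by
    by_contra! h
    exact hnot (mem_interior.2 ⟨_, h, isOpen_ball, mem_ball_self hε⟩)
  have hnear : ∀ y, dist y c ≤ ε → ‖G y‖ < 1 / 16 := fun y hy => by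
    refine hsmall y ((dist_triangle y c (g 0)).trans_lt ?_)
    have : dist c (g 0) < ε := hcball
    linarith [show 3 * ε = η by simp only [ε]; ring]
  obtain ⟨δ, hδ, hδ16, hδG⟩ : ∃ δ > 0, δ ≤ 1 / 16 ∧ ∀ y ∈ S \ ball c ε, δ ≤ ‖G y‖ := by
    have hGne : ∀ y ∈ S \ ball c ε, 0 < ‖G y‖ := by
      rintro _ ⟨⟨x, hx, rfl⟩, hy⟩
      rw [hG x hx, norm_pos_iff]
      rintro rfl
      exact hy (mem_ball_comm.1 hcball)
    obtain ⟨m, hm, hmle⟩ := (hS.diff isOpen_ball).exists_forall_le' (a := 0)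
      G.continuous.norm.continuousOn hGne
    exact ⟨min m (1 / 16), by positivity, min_le_right _ _,
      fun y hy => (min_le_left _ _).trans (hmle y hy)⟩
  obtain ⟨P, hP, hPG, -⟩ := G.continuous.exists_contDiff_approx 1
    (ε := fun _ => δ / 2) continuous_const fun _ => by positivity
  obtain ⟨a, ha, haP⟩ := exists_small_notMem_image_sphere hP c hε (half_pos hδ)
  have hclose : ∀ y, ‖P y - a - G y‖ < δ := fun y => by
    have h := hPG y
    rw [dist_eq_norm] at h
    rw [sub_right_comm]
    linarith [norm_sub_le (P y - G y) a]
  set Φ : E → E := fun y => c + max (ε / ‖y - c‖) 1 • (y - c)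
  have hne : ∀ y ∈ S, ‖y - c‖ ≠ 0 := fun y hy h =>
    hcS (sub_eq_zero.1 (norm_eq_zero.1 h) ▸ hy)
  have hΦfar : ∀ y ∈ S, ε ≤ ‖y - c‖ → Φ y = y := fun y _ h => by
    have : max (ε / ‖y - c‖) 1 = 1 := max_eq_right (div_le_one_of_le₀ h (norm_nonneg _))
    simp [Φ, this]
  have hΦnear : ∀ y ∈ S, ‖y - c‖ < ε → Φ y ∈ sphere c ε := fun y hy h => by
    have hpos := (norm_nonneg (y - c)).lt_of_ne' (hne y hy)
    have : max (ε / ‖y - c‖) 1 = ε / ‖y - c‖ := max_eq_left ((one_le_div hpos).2 h.le)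
    rw [mem_sphere_iff_norm]
    simp only [Φ, this, add_sub_cancel_left, norm_smul, norm_div, norm_norm,
      Real.norm_of_nonneg hε.le]
    exact div_mul_cancel₀ _ hpos.ne'
  have hΦ : ContinuousOn Φ S := by
    have h : ContinuousOn (fun y => ‖y - c‖) S := by fun_prop
    exact continuousOn_const.add ((ContinuousOn.sup (continuousOn_const.div h hne) continuousOn_const).smul
      (continuousOn_id.sub continuousOn_const))
  obtain ⟨x, hx, hx0⟩ := exists_eq_zero_of_norm_sub_le (F := fun x => P (Φ (g x)) - a)
    ((hP.continuous.comp_continuousOn (hΦ.comp hg.continuousOn (mapsTo_image g B))).sub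
      continuousOn_const) fun x hx => by
    have hy : g x ∈ S := mem_image_of_mem g hx
    rcases le_or_gt ε ‖g x - c‖ with h | h
    · rw [hΦfar _ hy h]
      have := hclose (g x)
      rw [hG x hx] at this
      linarith
    · have h1 := hclose (Φ (g x))
      have h2 := hnear (Φ (g x)) (mem_sphere.1 (hΦnear _ hy h)).le
      have h3 := hnear (g x) (by rw [dist_eq_norm]; exact h.le)
      rw [hG x hx] at h3
      have h4 := norm_sub_norm_le (P (Φ (g x)) - a) (G (Φ (g x)))
      linarith [norm_sub_le (P (Φ (g x)) - a) x]
  have hy : g x ∈ S := mem_image_of_mem g hx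
  rcases le_or_gt ε ‖g x - c‖ with h | h
  · have h1 := hclose (g x)
    simp only [hΦfar _ hy h] at hx0
    rw [hx0, zero_sub, norm_neg] at h1
    exact absurd (hδG (g x) ⟨hy, by rw [mem_ball_iff_norm]; exact not_lt.2 h⟩) (not_le.2 h1)
  · exact haP ⟨_, hΦnear _ hy h, sub_eq_zero.1 hx0⟩

open Metric in
/-- **Invariance of domain**: an injective continuous self-map of a Euclidean space is open. -/
theorem Continuous.isOpenMap_of_injective {E : Type*} [NormedAddCommGroup E]
    [InnerProductSpace ℝ E] [FiniteDimensional ℝ E] {g : E → E} (hg : Continuous g)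
    (hinj : Function.Injective g) : IsOpenMap g := by
  intro U hU
  rw [isOpen_iff_mem_nhds]
  rintro _ ⟨x, hx, rfl⟩
  obtain ⟨r, hr, hrU⟩ := Metric.nhds_basis_closedBall.mem_iff.1 (hU.mem_nhds hx)
  have h := Continuous.mem_interior_image_closedBall_of_injective (g := fun y => g (x + r • y))
    (by fun_prop) (hinj.comp ((add_right_injective x).comp (smul_right_injective E hr.ne')))
  simp only [smul_zero, add_zero] at h
  refine Filter.mem_of_superset (mem_interior_iff_mem_nhds.1 h) ?_
  rintro _ ⟨y, hy, rfl⟩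
  refine mem_image_of_mem g (hrU ?_)
  rw [mem_closedBall_zero_iff] at hy
  rw [mem_closedBall_iff_norm, add_sub_cancel_left, norm_smul, Real.norm_of_nonneg hr.le]
  exact mul_le_of_le_one_right hr.le hy

/-- A global attractor of an injective continuous map `f : ℝ³ → ℝ³` is cellular. -/
theorem global_attractor_is_cellular (f : R3 → R3) (hfc : Continuous f)
    (hfi : Function.Injective f) (K : Set R3) (hK : IsCompact K) (hinv : f '' K = K)
    (hglobal : ∀ P : Set R3, IsCompact P → IsAttracted f K P) :
    IsCellular K := by
  intro V hV hKV
  obtain ⟨R, hR, hKR⟩ := hK.isBounded.subset_ball_lt 0 0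
  obtain ⟨n, hn⟩ := hglobal (Metric.closedBall 0 R) (isCompact_closedBall 0 R) V
    (by rwa [hV.interior_eq])
  have hsub := hn n le_rfl
  have hnK : f^[n] '' K = K := by
    rw [Set.image_iterate_eq]
    exact Function.iterate_fixed hinv n
  have hnc : Continuous f^[n] := hfc.iterate n
  have hni : Function.Injective f^[n] := hfi.iterate n
  set g : R3 → R3 := fun x => f^[n] (R • x)
  have hgc : Continuous g := hnc.comp (continuous_const_smul R)
  have hgi : Function.Injective g := hni.comp (smul_right_injective R3 hR.ne')
  have himage : g '' Metric.closedBall 0 1 = f^[n] '' Metric.closedBall 0 R := by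
    have h : (fun x => R • x) '' Metric.closedBall (0 : R3) 1 = Metric.closedBall 0 R := by
      rw [Set.image_smul, smul_unitClosedBall_of_nonneg hR.le]
    rw [← h, Set.image_image]
  refine ⟨g '' Metric.closedBall 0 1, ?_, himage ▸ hsub, ?_⟩
  · rw [himage]
    refine Subset.trans ?_ (interior_maximal (image_mono Metric.ball_subset_closedBall)
      (hnc.isOpenMap_of_injective hni _ Metric.isOpen_ball))
    calc K = f^[n] '' K := hnK.symm
      _ ⊆ f^[n] '' Metric.ball 0 R := image_mono hKR
  · have : CompactSpace (Metric.closedBall (0 : R3) 1) :=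
      isCompact_iff_compactSpace.1 (isCompact_closedBall 0 1)
    have hc : Continuous (Equiv.Set.image g (Metric.closedBall 0 1) hgi) :=
      (hgc.comp continuous_subtype_val).subtype_mk _
    exact ⟨hc.homeoOfEquivCompactToT2.symm⟩
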